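/- Let a, b > 0 and N ∈ ℕ. If 0 ≤ ν < 1/2, then (1−2ν)^{2ν} · K( (b/((1−2ν)a))^{1/2^{N}}, 2 )^{β_N(2ν)} · (a^ν b^{1−ν})² + ν²(a+b)² + (1−2ν) b · S_N( 1−2ν; b/(1−2ν), a ) ≤ (ν a + (1−ν) b)². If 1/2 < ν ≤ 1, then (2ν−1)^{2−2ν} · K( ((2ν−1)b/a)^{1/2^{N}}, 2 )^{β_N(2ν−1)} · (a^ν b^{1−ν})² + (1−ν)²(a+b)² + (2ν−1) a · S_N( 2ν−1; a/(2ν−1), b ) ≤ (ν a + (1−ν) b)². -/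

import Mathlib

open Real Finset

noncomputable def kj (j : ℕ) (ν : ℝ) : ℤ := ⌊(2:ℝ)^(j-1) * ν⌋

noncomputable def rj (j : ℕ) (ν : ℝ) : ℤ := ⌊(2:ℝ)^j * ν⌋

noncomputable def sj (j : ℕ) (ν : ℝ) : ℝ :=
  (-1:ℝ)^(rj j ν) * (2:ℝ)^(j-1) * ν
    + (-1:ℝ)^(rj j ν + 1) * (⌊((rj j ν : ℝ) + 1)/2⌋ : ℤ)

noncomputable def SS (N : ℕ) (ν a b : ℝ) : ℝ :=
  ∑ j ∈ Finset.Icc 1 N, sj j ν *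
    ((b ^ ((2:ℝ)^(j-1) - (kj j ν : ℝ)) * a ^ ((kj j ν : ℝ))) ^ ((1:ℝ)/2^j)
      - (a ^ ((kj j ν : ℝ) + 1) * b ^ ((2:ℝ)^(j-1) - (kj j ν : ℝ) - 1)) ^ ((1:ℝ)/2^j))^2

noncomputable def Kc (t : ℝ) : ℝ := (t + 1)^2 / (4 * t)

noncomputable def betaN (N : ℕ) (ν : ℝ) : ℝ :=
  min (1 + (⌊(2:ℝ)^N * ν⌋ : ℝ) - (2:ℝ)^N * ν) ((2:ℝ)^N * ν - (⌊(2:ℝ)^N * ν⌋ : ℝ))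

/-- The weighted geometric mean `a ^ x * b ^ (1 - x)`. -/
noncomputable def geomMean (a b x : ℝ) : ℝ := a ^ x * b ^ (1 - x)

lemma geomMean_pos {a b : ℝ} (ha : 0 < a) (hb : 0 < b) (x : ℝ) : 0 < geomMean a b x := by
  unfold geomMean; positivity

lemma rpow_half_mul_rpow_half {a b : ℝ} (ha : 0 < a) (hb : 0 < b) (x y : ℝ) :
    (a ^ (x / 2) * b ^ ((1 - x) / 2)) * (a ^ (y / 2) * b ^ ((1 - y) / 2))
      = geomMean a b ((x + y) / 2) := by
  have h₁ : a ^ (x / 2) * a ^ (y / 2) = a ^ ((x + y) / 2) := by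
    rw [← rpow_add ha]; congr 1; ring
  have h₂ : b ^ ((1 - x) / 2) * b ^ ((1 - y) / 2) = b ^ (1 - (x + y) / 2) := by
    rw [← rpow_add hb]; congr 1; ring
  rw [geomMean, ← h₁, ← h₂]; ring

lemma mul_rpow_rpow {a b : ℝ} (ha : 0 < a) (hb : 0 < b) (p q c : ℝ) :
    (a ^ p * b ^ q) ^ c = a ^ (p * c) * b ^ (q * c) := by
  rw [mul_rpow (by positivity) (by positivity), ← rpow_mul ha.le, ← rpow_mul hb.le]

/-- The interpolation at `ν` of the values of `geomMean a b` at the two adjacent points of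
`2⁻ᴺ ℤ`. -/
noncomputable def dyadicInterp (N : ℕ) (ν a b : ℝ) : ℝ :=
  (1 - Int.fract ((2:ℝ) ^ N * ν)) * geomMean a b (⌊(2:ℝ) ^ N * ν⌋ / 2 ^ N)
    + Int.fract ((2:ℝ) ^ N * ν) * geomMean a b ((⌊(2:ℝ) ^ N * ν⌋ + 1) / 2 ^ N)

lemma sj_succ_of_fract_lt {n : ℕ} {ν : ℝ} (h : Int.fract ((2:ℝ) ^ n * ν) < 1 / 2) :
    ⌊(2:ℝ) ^ (n + 1) * ν⌋ = 2 * ⌊(2:ℝ) ^ n * ν⌋ ∧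
      sj (n + 1) ν = Int.fract ((2:ℝ) ^ n * ν) := by
  have hx := Int.floor_add_fract ((2:ℝ) ^ n * ν)
  have h0 := Int.fract_nonneg ((2:ℝ) ^ n * ν)
  have hr : ⌊(2:ℝ) ^ (n + 1) * ν⌋ = 2 * ⌊(2:ℝ) ^ n * ν⌋ := by
    rw [Int.floor_eq_iff, pow_succ]
    push_cast
    constructor <;> linarith
  have hf : ⌊(((2 * ⌊(2:ℝ) ^ n * ν⌋ : ℤ) : ℝ) + 1) / 2⌋ = ⌊(2:ℝ) ^ n * ν⌋ := by
    rw [Int.floor_eq_iff]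
    push_cast
    constructor <;> linarith
  refine ⟨hr, ?_⟩
  have he : Even (2 * ⌊(2:ℝ) ^ n * ν⌋) := even_two_mul _
  rw [sj, rj, hr, hf, he.neg_one_zpow, he.add_one.neg_one_zpow, Nat.add_sub_cancel]
  linarith

lemma sj_succ_of_le_fract {n : ℕ} {ν : ℝ} (h : 1 / 2 ≤ Int.fract ((2:ℝ) ^ n * ν)) :
    ⌊(2:ℝ) ^ (n + 1) * ν⌋ = 2 * ⌊(2:ℝ) ^ n * ν⌋ + 1 ∧
      sj (n + 1) ν = 1 - Int.fract ((2:ℝ) ^ n * ν) := by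
  have hx := Int.floor_add_fract ((2:ℝ) ^ n * ν)
  have h1 := Int.fract_lt_one ((2:ℝ) ^ n * ν)
  have hr : ⌊(2:ℝ) ^ (n + 1) * ν⌋ = 2 * ⌊(2:ℝ) ^ n * ν⌋ + 1 := by
    rw [Int.floor_eq_iff, pow_succ]
    push_cast
    constructor <;> linarith
  have hf : ⌊(((2 * ⌊(2:ℝ) ^ n * ν⌋ + 1 : ℤ) : ℝ) + 1) / 2⌋ = ⌊(2:ℝ) ^ n * ν⌋ + 1 := by
    rw [Int.floor_eq_iff]
    push_cast
    constructor <;> linarith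
  refine ⟨hr, ?_⟩
  have ho : Odd (2 * ⌊(2:ℝ) ^ n * ν⌋ + 1) := odd_two_mul_add_one _
  rw [sj, rj, hr, hf, ho.neg_one_zpow, ho.add_one.neg_one_zpow, Nat.add_sub_cancel]
  push_cast
  linarith

lemma dyadicInterp_succ {a b : ℝ} (ha : 0 < a) (hb : 0 < b) (n : ℕ) (ν : ℝ) :
    dyadicInterp (n + 1) ν a b + sj (n + 1) ν *
      ((b ^ ((2:ℝ)^n - (kj (n + 1) ν : ℝ)) * a ^ ((kj (n + 1) ν : ℝ))) ^ ((1:ℝ)/2^(n + 1))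
      - (a ^ ((kj (n + 1) ν : ℝ) + 1) * b ^ ((2:ℝ)^n - (kj (n + 1) ν : ℝ) - 1))
          ^ ((1:ℝ)/2^(n + 1)))^2
      = dyadicInterp n ν a b := by
  have hx := Int.floor_add_fract ((2:ℝ) ^ n * ν)
  have hx' := Int.floor_add_fract ((2:ℝ) ^ (n + 1) * ν)
  have hk : kj (n + 1) ν = ⌊(2:ℝ) ^ n * ν⌋ := by simp [kj]
  have h2 : (2:ℝ) ^ n ≠ 0 := by positivity
  rw [hk]
  unfold dyadicInterp
  have hs₁ := @sj_succ_of_fract_lt n ν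
  have hs₂ := @sj_succ_of_le_fract n ν
  set t := Int.fract ((2:ℝ) ^ n * ν)
  set t' := Int.fract ((2:ℝ) ^ (n + 1) * ν)
  generalize ⌊(2:ℝ) ^ n * ν⌋ = k at *
  have hu : (b ^ ((2:ℝ)^n - (k : ℝ)) * a ^ (k : ℝ)) ^ ((1:ℝ)/2^(n + 1))
      = a ^ ((k / 2 ^ n : ℝ) / 2) * b ^ ((1 - k / 2 ^ n : ℝ) / 2) := by
    rw [mul_comm, mul_rpow_rpow ha hb]
    congr 2 <;> field_simp <;> ring
  have hv : (a ^ ((k : ℝ) + 1) * b ^ ((2:ℝ)^n - (k : ℝ) - 1)) ^ ((1:ℝ)/2^(n + 1))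
      = a ^ (((k + 1) / 2 ^ n : ℝ) / 2) * b ^ ((1 - (k + 1) / 2 ^ n : ℝ) / 2) := by
    rw [mul_rpow_rpow ha hb]
    congr 2 <;> field_simp <;> ring
  rw [hu, hv]
  have huu := rpow_half_mul_rpow_half ha hb (k / 2 ^ n : ℝ) (k / 2 ^ n : ℝ)
  have huv := rpow_half_mul_rpow_half ha hb (k / 2 ^ n : ℝ) ((k + 1) / 2 ^ n : ℝ)
  have hvv := rpow_half_mul_rpow_half ha hb ((k + 1) / 2 ^ n : ℝ) ((k + 1) / 2 ^ n : ℝ)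
  rw [add_self_div_two] at huu hvv
  have hmid : ((k / 2 ^ n : ℝ) + (k + 1) / 2 ^ n) / 2 = (2 * k + 1) / 2 ^ (n + 1) := by
    field_simp; ring
  have hl : (k / 2 ^ n : ℝ) = 2 * k / 2 ^ (n + 1) := by field_simp; ring
  have hr : ((k + 1) / 2 ^ n : ℝ) = (2 * k + 1 + 1) / 2 ^ (n + 1) := by field_simp; ring
  rw [hmid] at huv
  generalize a ^ ((k / 2 ^ n : ℝ) / 2) * b ^ ((1 - k / 2 ^ n : ℝ) / 2) = u at *
  generalize a ^ (((k + 1) / 2 ^ n : ℝ) / 2) * b ^ ((1 - (k + 1) / 2 ^ n : ℝ) / 2) = v at *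
  rw [← huu, ← hvv]
  rw [pow_succ, mul_right_comm] at hx'
  rcases lt_or_ge t (1 / 2) with h | h
  · obtain ⟨hf, hs⟩ := hs₁ h
    rw [pow_succ, mul_right_comm] at hf
    rw [hf] at hx'
    rw [hs, pow_succ, mul_right_comm, hf, ← pow_succ]
    push_cast at hx' ⊢
    rw [← hl, ← huu, ← huv]
    have : t' = 2 * t := by linarith
    rw [this]; ring
  · obtain ⟨hf, hs⟩ := hs₂ h
    rw [pow_succ, mul_right_comm] at hf
    rw [hf] at hx'
    rw [hs, pow_succ, mul_right_comm, hf, ← pow_succ]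
    push_cast at hx' ⊢
    rw [← hr, ← hvv, ← huv]
    have : t' = 2 * t - 1 := by linarith
    rw [this]; ring

lemma dyadicInterp_add_SS {a b : ℝ} (ha : 0 < a) (hb : 0 < b) (N : ℕ) (ν : ℝ) :
    dyadicInterp N ν a b + SS N ν a b = dyadicInterp 0 ν a b := by
  induction N with
  | zero => simp [SS]
  | succ n ih =>
    rw [← ih, ← dyadicInterp_succ ha hb n ν, SS, Finset.sum_Icc_succ_top (by omega), ← SS,
      Nat.add_sub_cancel]
    ring

lemma dyadicInterp_zero {a b ν : ℝ} (h0 : 0 ≤ ν) (h1 : ν ≤ 1) :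
    dyadicInterp 0 ν a b = ν * a + (1 - ν) * b := by
  rcases h1.lt_or_eq with h1 | rfl
  · have hf : ⌊ν⌋ = 0 := Int.floor_eq_iff.2 ⟨by simpa, by simpa⟩
    simp [dyadicInterp, geomMean, Int.fract, hf]
    ring
  · simp [dyadicInterp, geomMean]

lemma Kc_inv {t : ℝ} (ht : 0 < t) : Kc t⁻¹ = Kc t := by
  unfold Kc; field_simp; ring

lemma Kc_div_rpow_mul_le {p q t : ℝ} (hp : 0 < p) (hq : 0 < q) (h0 : 0 ≤ t) (h : t ≤ 1 / 2) :
    Kc (q / p) ^ t * (p ^ (1 - t) * q ^ t) ≤ (1 - t) * p + t * q := by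
  have hK : Kc (q / p) = ((p + q) / 2) ^ (2:ℝ) * (p ^ (-1:ℝ) * q ^ (-1:ℝ)) := by
    rw [rpow_neg_one, rpow_neg_one, rpow_two]; unfold Kc; field_simp; ring
  have hm : 0 < (p + q) / 2 := by positivity
  have hE : Kc (q / p) ^ t * (p ^ (1 - t) * q ^ t)
      = p ^ (1 - 2 * t) * ((p + q) / 2) ^ (2 * t) := by
    have hp' : p ^ (-1 * t) * p ^ (1 - t) = p ^ (1 - 2 * t) := by
      rw [← rpow_add hp]; congr 1; ring
    have hq' : q ^ (-1 * t) * q ^ t = 1 := by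
      rw [← rpow_add hq]; simp
    rw [hK, mul_rpow (by positivity) (by positivity), mul_rpow_rpow hp hq, ← rpow_mul hm.le,
      ← hp']
    linear_combination ((p + q) / 2) ^ (2 * t) * p ^ (-1 * t) * p ^ (1 - t) * hq'
  rw [hE]
  have := geom_mean_le_arith_mean2_weighted (w₁ := 1 - 2 * t) (w₂ := 2 * t) (by linarith)
    (by linarith) hp.le hm.le (by ring)
  linarith

lemma Kc_div_rpow_min_mul_le {p q t : ℝ} (hp : 0 < p) (hq : 0 < q) (h0 : 0 ≤ t) (h1 : t ≤ 1) :
    Kc (q / p) ^ min (1 - t) t * (p ^ (1 - t) * q ^ t) ≤ (1 - t) * p + t * q := by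
  rcases le_total t (1 / 2) with h | h
  · rw [min_eq_right (by linarith)]
    exact Kc_div_rpow_mul_le hp hq h0 h
  · rw [min_eq_left (by linarith), ← inv_div, Kc_inv (by positivity)]
    have := Kc_div_rpow_mul_le (t := 1 - t) hq hp (by linarith) (by linarith)
    rw [sub_sub_cancel] at this
    linarith [mul_comm (p ^ (1 - t)) (q ^ t)]

lemma betaN_eq (N : ℕ) (ν : ℝ) :
    betaN N ν = min (1 - Int.fract ((2:ℝ) ^ N * ν)) (Int.fract ((2:ℝ) ^ N * ν)) := by
  unfold betaN Int.fract; congr 1; ring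

lemma betaN_one_sub (N : ℕ) (ν : ℝ) : betaN N (1 - ν) = betaN N ν := by
  have h : (2:ℝ) ^ N * (1 - ν) = -((2:ℝ) ^ N * ν) + ((2 ^ N : ℕ) : ℝ) := by push_cast; ring
  rw [betaN_eq, betaN_eq, h, Int.fract_add_natCast]
  rcases eq_or_ne (Int.fract ((2:ℝ) ^ N * ν)) 0 with h0 | h0
  · rw [Int.fract_neg_eq_zero.2 h0, h0]
  · rw [Int.fract_neg h0, sub_sub_cancel, min_comm]

lemma Kc_rpow_betaN_mul_le_dyadicInterp {a b : ℝ} (ha : 0 < a) (hb : 0 < b) (N : ℕ) (ν : ℝ) :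
    Kc ((a / b) ^ ((1:ℝ) / 2 ^ N)) ^ betaN N ν * (a ^ ν * b ^ (1 - ν))
      ≤ dyadicInterp N ν a b := by
  have hx := Int.floor_add_fract ((2:ℝ) ^ N * ν)
  rw [betaN_eq]
  unfold dyadicInterp
  have h0 := Int.fract_nonneg ((2:ℝ) ^ N * ν)
  have h1 := (Int.fract_lt_one ((2:ℝ) ^ N * ν)).le
  generalize Int.fract ((2:ℝ) ^ N * ν) = t at *
  generalize (⌊(2:ℝ) ^ N * ν⌋ : ℝ) = k at *
  have h2 : (2:ℝ) ^ N ≠ 0 := by positivity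
  have key := Kc_div_rpow_min_mul_le (geomMean_pos ha hb (k / 2 ^ N))
    (geomMean_pos ha hb ((k + 1) / 2 ^ N)) h0 h1
  have hq : geomMean a b ((k + 1) / 2 ^ N) / geomMean a b (k / 2 ^ N)
      = (a / b) ^ ((1:ℝ) / 2 ^ N) := by
    rw [div_eq_iff (geomMean_pos ha hb _).ne', div_rpow ha.le hb.le,
      div_eq_mul_inv (a ^ _),
      ← rpow_neg hb.le, geomMean, geomMean, mul_mul_mul_comm, ← rpow_add ha, ← rpow_add hb]
    congr 2 <;> ring
  have hν : ν = (k + t) / 2 ^ N := by rw [hx]; field_simp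
  have hg : geomMean a b (k / 2 ^ N) ^ (1 - t) * geomMean a b ((k + 1) / 2 ^ N) ^ t
      = a ^ ν * b ^ (1 - ν) := by
    unfold geomMean
    rw [mul_rpow_rpow ha hb, mul_rpow_rpow ha hb, mul_mul_mul_comm, ← rpow_add ha,
      ← rpow_add hb, hν]
    congr 2 <;> ring
  rwa [hq, hg] at key

/-- A multiple-term refinement of the weighted arithmetic-geometric mean inequality, with the
Kantorovich constant. -/
lemma Kc_rpow_betaN_mul_add_SS_le {a b ν : ℝ} (ha : 0 < a) (hb : 0 < b) (N : ℕ)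
    (h0 : 0 ≤ ν) (h1 : ν ≤ 1) :
    Kc ((a / b) ^ ((1:ℝ) / 2 ^ N)) ^ betaN N ν * (a ^ ν * b ^ (1 - ν)) + SS N ν a b
      ≤ ν * a + (1 - ν) * b := by
  rw [← dyadicInterp_zero h0 h1, ← dyadicInterp_add_SS ha hb N ν]
  linarith [Kc_rpow_betaN_mul_le_dyadicInterp ha hb N ν]

lemma mul_mul_div_rpow_mul_rpow {c x y : ℝ} (hc : 0 < c) (hx : 0 < x) (hy : 0 < y) :
    c * x * ((x / c) ^ c * y ^ (1 - c))
      = c ^ (1 - c) * (y ^ ((1 - c) / 2) * x ^ ((1 + c) / 2)) ^ 2 := by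
  rw [div_rpow hx.le hc.le, rpow_sub hc, rpow_one, mul_pow, ← rpow_mul_natCast hy.le,
    ← rpow_mul_natCast hx.le]
  have h₁ : x ^ ((1 + c) / 2 * ((2:ℕ):ℝ)) = x * x ^ c := by
    rw [← rpow_one_add' hx.le (by positivity)]; congr 1; push_cast; ring
  have h₂ : (1 - c) / 2 * ((2:ℕ):ℝ) = 1 - c := by push_cast; ring
  rw [h₁, h₂]
  ring

theorem stmt12 (a b ν : ℝ) (ha : 0 < a) (hb : 0 < b) (N : ℕ) :
    (0 ≤ ν → ν < 1/2 →
      (1 - 2*ν) ^ (2*ν) * Kc ((b/((1 - 2*ν) * a)) ^ ((1:ℝ)/2^N)) ^ (betaN N (2*ν))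
          * (a ^ ν * b ^ (1 - ν))^2
        + ν^2 * (a + b)^2
        + (1 - 2*ν) * b * SS N (1 - 2*ν) (b/(1 - 2*ν)) a
        ≤ (ν * a + (1 - ν) * b)^2) ∧
    (1/2 < ν → ν ≤ 1 →
      (2*ν - 1) ^ (2 - 2*ν) * Kc (((2*ν - 1) * b / a) ^ ((1:ℝ)/2^N)) ^ (betaN N (2*ν - 1))
          * (a ^ ν * b ^ (1 - ν))^2
        + (1 - ν)^2 * (a + b)^2
        + (2*ν - 1) * a * SS N (2*ν - 1) (a/(2*ν - 1)) b
        ≤ (ν * a + (1 - ν) * b)^2) := by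
  constructor
  · intro h0 h1
    have hc : 0 < 1 - 2 * ν := by linarith
    have key := mul_le_mul_of_nonneg_left (Kc_rpow_betaN_mul_add_SS_le (div_pos hb hc) ha N hc.le
      (by linarith)) (mul_pos hc hb).le
    have hg := mul_mul_div_rpow_mul_rpow hc hb ha
    rw [show (1 - (1 - 2 * ν)) / 2 = ν by ring, show (1 + (1 - 2 * ν)) / 2 = 1 - ν by ring] at hg
    rw [div_div, betaN_one_sub, mul_add, mul_left_comm, hg] at key
    rw [show (1 - 2 * ν) * b * ((1 - 2 * ν) * (b / (1 - 2 * ν)) + (1 - (1 - 2 * ν)) * a)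
      = (1 - 2 * ν) * b * (b + 2 * ν * a) by field_simp; ring,
      show 1 - (1 - 2 * ν) = 2 * ν by ring] at key
    linear_combination key
  · intro h0 h1
    have hc : 0 < 2 * ν - 1 := by linarith
    have key := mul_le_mul_of_nonneg_left (Kc_rpow_betaN_mul_add_SS_le (div_pos ha hc) hb N hc.le
      (by linarith)) (mul_pos hc ha).le
    have hg := mul_mul_div_rpow_mul_rpow hc ha hb
    rw [show (1 - (2 * ν - 1)) / 2 = 1 - ν by ring, show (1 + (2 * ν - 1)) / 2 = ν by ring] at hg
    have hi : a / (2 * ν - 1) / b = ((2 * ν - 1) * b / a)⁻¹ := by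
      rw [inv_div, div_div]
    rw [hi, inv_rpow (by positivity), Kc_inv (by positivity), mul_add, mul_left_comm, hg] at key
    rw [show (2 * ν - 1) * a * ((2 * ν - 1) * (a / (2 * ν - 1)) + (1 - (2 * ν - 1)) * b)
      = (2 * ν - 1) * a * (a + (2 - 2 * ν) * b) by field_simp; ring,
      show 1 - (2 * ν - 1) = 2 - 2 * ν by ring] at key
    linear_combination key
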